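/- Let Ω = {v ∈ ℝ² : W(v) ≠ 0} and f = log(Re W) on Ω. Let λ > 1 and let n be a real number with 2 < n < 2λ. Then for every ρ ∈ ℝ there exist a point v ∈ Ω and a vector u ∈ ℝ² such that −((λ−1)/3)·Hess f(v)(u,u) < ρ·|u|² + (1/(n−2))·((λ−1)/3)²·⟨∇f(v), u⟩². (That is, the deltoid operator ℒ^{(λ)} = Δ + ((λ−1)/3)∇f·∇ satisfies no curvature-dimension inequality CD(ρ, n) for any n < 2λ.) -/

import Mathlib

open scoped RealInnerProductSpace
noncomputable section

/-- The plane `ℝ²`. -/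
abbrev Plane := EuclideanSpace ℝ (Fin 2)

/-- The three unit vectors `E₁ = (1,0)`, `E₂ = (−1/2, √3/2)`, `E₃ = (−1/2, −√3/2)`. -/
def E : Fin 3 → Plane := fun k =>
  (WithLp.equiv 2 (Fin 2 → ℝ)).symm
    (![![1, 0], ![-(1/2), Real.sqrt 3 / 2], ![-(1/2), -(Real.sqrt 3 / 2)]] k)

/-- `z_k(v) = exp(i⟨v, E_k⟩)`. -/
def z (k : Fin 3) (v : Plane) : ℂ := Complex.exp (Complex.I * ((⟪v, E k⟫ : ℝ) : ℂ))

/-- `W = −((z₁−z₂)(z₂−z₃)(z₃−z₁))²`. -/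
def W (v : Plane) : ℂ :=
  -((z 0 v - z 1 v) * (z 1 v - z 2 v) * (z 2 v - z 0 v)) ^ 2

/-- The open set `Ω = {W ≠ 0}`. -/
def Omega : Set Plane := {v | W v ≠ 0}

/-- `f = log (Re W)`. -/
def fdel (v : Plane) : ℝ := Real.log (W v).re

/-- The Hessian (second Fréchet derivative) of a scalar function, as a bilinear form. -/
def Hess (g : Plane → ℝ) (v u w : Plane) : ℝ := fderiv ℝ (fderiv ℝ g) v u w

/-- The half difference `v ↦ ⟨E_k - E_{k+1}, v⟩ / 2` of two phases, as a linear form. -/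
def halfDiff (k : Fin 3) : Plane →L[ℝ] ℝ := (1 / 2 : ℝ) • innerSL ℝ (E k - E (k + 1))

lemma E_sum : E 0 + E 1 + E 2 = 0 := by
  ext i
  fin_cases i
  · simp [E]
    norm_num
  · simp [E]

lemma exp_sub_exp_eq_sin (x y : ℂ) :
    Complex.exp (Complex.I * x) - Complex.exp (Complex.I * y) =
      Complex.exp (Complex.I * ((x + y) / 2)) *
        (2 * Complex.I * Complex.sin ((x - y) / 2)) := by
  have h1 : Complex.exp (Complex.I * x) =
      Complex.exp (Complex.I * ((x + y) / 2)) * Complex.exp ((x - y) / 2 * Complex.I) := by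
    rw [← Complex.exp_add]; ring_nf
  have h2 : Complex.exp (Complex.I * y) =
      Complex.exp (Complex.I * ((x + y) / 2)) * Complex.exp (-((x - y) / 2) * Complex.I) := by
    rw [← Complex.exp_add]; ring_nf
  rw [h1, h2, Complex.exp_mul_I, Complex.exp_mul_I, Complex.cos_neg, Complex.sin_neg]
  ring

lemma W_eq (v : Plane) :
    W v = ((64 * ∏ k, Real.sin (halfDiff k v) ^ 2 : ℝ) : ℂ) := by
  have hsum : ⟪v, E 0⟫ + ⟪v, E 1⟫ + ⟪v, E 2⟫ = 0 := by
    rw [← inner_add_right, ← inner_add_right, E_sum, inner_zero_right]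
  have hd (k : Fin 3) : halfDiff k v = (⟪v, E k⟫ - ⟪v, E (k + 1)⟫) / 2 := by
    simp only [halfDiff, smul_apply, innerSL_apply_apply, smul_eq_mul]
    rw [real_inner_comm, inner_sub_right]; ring
  simp only [W, z, exp_sub_exp_eq_sin, Fin.prod_univ_three, hd]
  simp only [zero_add, Fin.reduceAdd]
  generalize ⟪v, E 0⟫ = a, ⟪v, E 1⟫ = b, ⟪v, E 2⟫ = c at hsum ⊢
  have hexp : Complex.exp (Complex.I * ((a + b) / 2)) * Complex.exp (Complex.I * ((b + c) / 2)) *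
      Complex.exp (Complex.I * ((c + a) / 2)) = 1 := by
    rw [← Complex.exp_add, ← Complex.exp_add, Complex.exp_eq_one_iff]
    have hsum' : (a + b + c : ℂ) = 0 := by exact_mod_cast hsum
    exact ⟨0, by linear_combination Complex.I * hsum'⟩
  push_cast
  generalize Complex.exp (Complex.I * ((a + b) / 2)) = p,
    Complex.exp (Complex.I * ((b + c) / 2)) = q,
    Complex.exp (Complex.I * ((c + a) / 2)) = r at hexp ⊢
  generalize Complex.sin ((a - b) / 2) = x, Complex.sin ((b - c) / 2) = y,
    Complex.sin ((c - a) / 2) = w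
  calc _ = -64 * (p * q * r) ^ 2 * (Complex.I ^ 2) ^ 3 * (x * y * w) ^ 2 := by ring
    _ = _ := by rw [hexp, Complex.I_sq]; ring

lemma mem_Omega_iff {v : Plane} : v ∈ Omega ↔ ∀ k, Real.sin (halfDiff k v) ≠ 0 := by
  simp [Omega, W_eq, Finset.prod_eq_zero_iff, -Complex.ofReal_mul, -Complex.ofReal_prod]

lemma isOpen_Omega : IsOpen Omega := by
  have : Omega = ⋂ k, {v | Real.sin (halfDiff k v) ≠ 0} := by
    ext v; simp [mem_Omega_iff]
  rw [this]
  exact isOpen_iInter_of_finite fun k => isOpen_ne_fun (by fun_prop) continuous_const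

lemma fdel_eq {v : Plane} (hv : v ∈ Omega) :
    fdel v = Real.log 64 + ∑ k, 2 * Real.log (Real.sin (halfDiff k v)) := by
  rw [mem_Omega_iff] at hv
  rw [fdel, W_eq, Complex.ofReal_re, Real.log_mul (by norm_num)
    (Finset.prod_ne_zero_iff.2 fun k _ => pow_ne_zero 2 (hv k)),
    Real.log_prod fun k _ => pow_ne_zero 2 (hv k)]
  simp [Real.log_pow]

lemma hasFDerivAt_fdel {v : Plane} (hv : v ∈ Omega) :
    HasFDerivAt fdel
      (∑ k, (2 * (Real.cos (halfDiff k v) / Real.sin (halfDiff k v))) • halfDiff k) v := by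
  have h : HasFDerivAt
      (fun v => Real.log 64 + ∑ k, 2 * Real.log (Real.sin (halfDiff k v)))
      (∑ k, (2 * (Real.cos (halfDiff k v) / Real.sin (halfDiff k v))) • halfDiff k) v := by
    refine (HasFDerivAt.fun_sum fun k _ => ?_).const_add _
    have := ((((halfDiff k).hasFDerivAt (x := v)).sin).log (mem_Omega_iff.1 hv k)).const_mul 2
    refine this.congr_fderiv ?_
    simp only [smul_smul]
    congr 1
    ring
  exact h.congr_of_eventuallyEq
    (Filter.eventuallyEq_of_mem (isOpen_Omega.mem_nhds hv) fun w hw => fdel_eq hw)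

lemma inner_gradient_fdel {v : Plane} (hv : v ∈ Omega) (u : Plane) :
    ⟪gradient fdel v, u⟫ =
      ∑ k, 2 * (Real.cos (halfDiff k v) / Real.sin (halfDiff k v)) * halfDiff k u := by
  rw [gradient, InnerProductSpace.toDual_symm_apply, (hasFDerivAt_fdel hv).fderiv]
  simp

lemma Hess_fdel {v : Plane} (hv : v ∈ Omega) (u w : Plane) :
    Hess fdel v u w =
      ∑ k, -2 * (halfDiff k u * halfDiff k w) / Real.sin (halfDiff k v) ^ 2 := by
  have h : HasFDerivAt
      (fun v => ∑ k, (2 * (Real.cos (halfDiff k v) / Real.sin (halfDiff k v))) • halfDiff k)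
      (∑ k, ((-2 / Real.sin (halfDiff k v) ^ 2) • halfDiff k).smulRight (halfDiff k)) v := by
    refine HasFDerivAt.fun_sum fun k _ => ?_
    have hs := mem_Omega_iff.1 hv k
    have hc : HasDerivAt (fun x => 2 * (Real.cos x / Real.sin x))
        (-2 / Real.sin (halfDiff k v) ^ 2) (halfDiff k v) := by
      refine (((Real.hasDerivAt_cos _).fun_div (Real.hasDerivAt_sin _) hs).const_mul 2).congr_deriv ?_
      rw [← mul_div_assoc]
      congr 1
      linear_combination (-2) * Real.sin_sq_add_cos_sq (halfDiff k v)
    exact (hc.comp_hasFDerivAt v (halfDiff k).hasFDerivAt).smul_const (halfDiff k)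
  have h' := h.congr_of_eventuallyEq (f₁ := fderiv ℝ fdel)
    (Filter.eventuallyEq_of_mem (isOpen_Omega.mem_nhds hv) fun w hw => (hasFDerivAt_fdel hw).fderiv)
  rw [Hess, h'.fderiv]
  simp only [sum_apply, ContinuousLinearMap.smulRight_apply,
    smul_apply, smul_eq_mul]
  exact Finset.sum_congr rfl fun k _ => by ring

/-- A radial direction on which the three half differences are `-1`, `2`, `-1`. -/
def ray : Plane := !₂[0, 4 / Real.sqrt 3]

lemma halfDiff_ray (k : Fin 3) : halfDiff k ray = ![-1, 2, -1] k := by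
  have h : Real.sqrt 3 ≠ 0 := by positivity
  fin_cases k <;>
    simp [halfDiff, ray, E, EuclideanSpace.inner_eq_star_dotProduct] <;> field_simp <;> norm_num

/-- For `λ > 1` and `2 < n < 2λ`, the deltoid operator `ℒ^{(λ)} = Δ + ((λ−1)/3)∇f·∇`
satisfies no curvature-dimension inequality `CD(ρ, n)`. -/
theorem deltoid_no_CD_below_dimension :
    ∀ lam n : ℝ, 1 < lam → 2 < n → n < 2 * lam → ∀ ρ : ℝ,
      ∃ v ∈ Omega, ∃ u : Plane,
        -((lam - 1)/3) * Hess fdel v u u <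
          ρ * ‖u‖ ^ 2 + (1/(n - 2)) * ((lam - 1)/3) ^ 2 * ⟪gradient fdel v, u⟫ ^ 2 := by
  intro lam n hlam hn hnl ρ
  set κ := (lam - 1) / 3 with hκ
  have hκ0 : 0 < κ := by rw [hκ]; linarith
  have hlt : ∀ᶠ t in nhds (0 : ℝ),
      κ * (4 / Real.sinc t ^ 2 + 2 / Real.sinc (2 * t) ^ 2) <
        ρ * (t ^ 2 * ‖ray‖ ^ 2) + (1 / (n - 2)) * κ ^ 2 *
          (4 * (Real.cos t / Real.sinc t) + 2 * (Real.cos (2 * t) / Real.sinc (2 * t))) ^ 2 := by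
    refine ContinuousAt.eventually_lt ?_ ?_ ?_
    · have := Real.continuous_sinc
      fun_prop (disch := simp)
    · have := Real.continuous_sinc
      fun_prop (disch := simp)
    · have h2 : 0 < n - 2 := by linarith
      have h3 : n - 2 < 6 * κ := by rw [hκ]; linarith
      simp only [mul_zero, Real.sinc_zero, Real.cos_zero]
      rw [← sub_pos]
      have : ρ * ((0:ℝ) ^ 2 * ‖ray‖ ^ 2) + (1 / (n - 2)) * κ ^ 2 *
          (4 * (1 / 1) + 2 * (1 / 1)) ^ 2 - κ * (4 / 1 ^ 2 + 2 / 1 ^ 2) =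
          6 * κ * (6 * κ - (n - 2)) / (n - 2) := by
        field_simp
        ring
      rw [this]
      have : 0 < 6 * κ - (n - 2) := by linarith
      positivity
  have hne : ∀ᶠ t in nhds (0 : ℝ), Real.sinc t ≠ 0 ∧ Real.sinc (2 * t) ≠ 0 := by
    have := Real.continuous_sinc
    exact (ContinuousAt.eventually_ne (by fun_prop) (by simp)).and
      (ContinuousAt.eventually_ne (by fun_prop) (by simp))
  obtain ⟨t, ⟨hlt, hs, hs'⟩, ht⟩ := ((hlt.and hne).filter_mono nhdsWithin_le_nhds |>.and
    (self_mem_nhdsWithin : {0}ᶜ ∈ nhdsWithin (0 : ℝ) {0}ᶜ)).exists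
  replace ht : t ≠ 0 := ht
  have ht2 : 2 * t ≠ 0 := by simpa using ht
  rw [Real.sinc_of_ne_zero ht] at hs hlt
  rw [Real.sinc_of_ne_zero ht2] at hs' hlt
  have hst : Real.sin t ≠ 0 := (div_ne_zero_iff.1 hs).1
  have hst' : Real.sin (2 * t) ≠ 0 := (div_ne_zero_iff.1 hs').1
  have hray (k : Fin 3) : halfDiff k (t • ray) = ![-t, 2 * t, -t] k := by
    rw [map_smul, halfDiff_ray]
    fin_cases k <;> simp [mul_comm]
  have hv : t • ray ∈ Omega := by
    rw [mem_Omega_iff, Fin.forall_fin_succ, Fin.forall_fin_two]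
    simp [hray, hst, hst']
  refine ⟨t • ray, hv, t • ray, ?_⟩
  rw [Hess_fdel hv, inner_gradient_fdel hv, norm_smul, mul_pow, Real.norm_eq_abs, sq_abs]
  simp only [hray, Fin.sum_univ_three, Matrix.cons_val, Real.sin_neg, Real.cos_neg]
  convert hlt using 1
  · field_simp
    ring
  · congr 3
    field_simp
    ring
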